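/- Let H be a Krull monoid such that every non-unit a ∈ H \ H^× is contained in some divisorial ideal of H distinct from H. Then H is a BF-monoid: for every a ∈ H \ H^× the set of lengths L(a) is finite and non-empty. -/

import Mathlib

open scoped Pointwise

/-- `H` is a submonoid of the group `G` such that `G` is a left and a right
quotient group of `H` (i.e. `H` is a cancellative semigroup satisfying both
Ore conditions, embedded in its quotient group `G = q(H)`). -/
def IsQG {G : Type*} [Group G] (H : Submonoid G) : Prop :=
  (∀ g : G, ∃ a ∈ H, ∃ b ∈ H, g = a⁻¹ * b) ∧ (∀ g : G, ∃ c ∈ H, ∃ d ∈ H, g = c * d⁻¹)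

/-- Left quotient `(A :ₗ B) = {x ∈ G | x B ⊆ A}`. -/
def lq {G : Type*} [Group G] (A B : Set G) : Set G := {x | ∀ b ∈ B, x * b ∈ A}

/-- Right quotient `(A :ᵣ B) = {x ∈ G | B x ⊆ A}`. -/
def rq {G : Type*} [Group G] (A B : Set G) : Set G := {x | ∀ b ∈ B, b * x ∈ A}

/-- A fractional ideal of `H`: a two-sided `H`-module `𝔞 ⊆ G = q(H)` with
`c𝔞 ⊆ H` and `𝔞d ⊆ H` for some `c, d ∈ H`. -/
def IsFracIdeal {G : Type*} [Group G] (H : Submonoid G) (a : Set G) : Prop :=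
  (H : Set G) * a = a ∧ a * (H : Set G) = a ∧
  (∃ c ∈ H, ∀ x ∈ a, c * x ∈ H) ∧ (∃ d ∈ H, ∀ x ∈ a, x * d ∈ H)

/-- An ideal of `H`: a two-sided `H`-module contained in `H`. -/
def IsIdeal {G : Type*} [Group G] (H : Submonoid G) (a : Set G) : Prop :=
  a ⊆ (H : Set G) ∧ (H : Set G) * a = a ∧ a * (H : Set G) = a

/-- The divisorial closure `𝔞_v = (H :ₗ (H :ᵣ 𝔞))`. -/
def vOp {G : Type*} [Group G] (H : Submonoid G) (a : Set G) : Set G :=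
  lq (H : Set G) (rq (H : Set G) a)

/-- `H` is completely integrally closed:
`(𝔞 :ₗ 𝔞) = (𝔞 :ᵣ 𝔞) = H` for every non-empty ideal `𝔞` of `H`. -/
def IsCIC {G : Type*} [Group G] (H : Submonoid G) : Prop :=
  ∀ a : Set G, IsIdeal H a → a.Nonempty → lq a a = (H : Set G) ∧ rq a a = (H : Set G)

/-- A divisorial ideal of `H`: an ideal `𝔞` with
`𝔞 = (H :ₗ (H :ᵣ 𝔞)) = (H :ᵣ (H :ₗ 𝔞))`. -/
def IsDivIdealFull {G : Type*} [Group G] (H : Submonoid G) (a : Set G) : Prop :=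
  IsIdeal H a ∧ a = lq (H : Set G) (rq (H : Set G) a) ∧
    a = rq (H : Set G) (lq (H : Set G) a)

/-- `H` is v-noetherian: the ascending chain condition on divisorial ideals. -/
def VNoethFull {G : Type*} [Group G] (H : Submonoid G) : Prop :=
  ∀ f : ℕ → Set G, (∀ n, IsDivIdealFull H (f n)) → (∀ n, f n ⊆ f (n + 1)) →
    ∃ N, ∀ n, N ≤ n → f n = f N

/-- `H` is a Krull monoid: completely integrally closed and v-noetherian. -/
def IsKrull {G : Type*} [Group G] (H : Submonoid G) : Prop :=
  IsCIC H ∧ VNoethFull H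

/-- The set of invertible elements `H^×` of `H`. -/
def unitSet {G : Type*} [Group G] (H : Submonoid G) : Set G :=
  {u | u ∈ H ∧ u⁻¹ ∈ H}

/-- `a` is an atom of `H`: a non-unit which is not a product of two non-units. -/
def IsAtomOf {G : Type*} [Group G] (H : Submonoid G) (a : G) : Prop :=
  a ∈ H ∧ a ∉ unitSet H ∧
  ∀ u ∈ H, ∀ v ∈ H, a = u * v → u ∈ unitSet H ∨ v ∈ unitSet H

/-- The set of lengths `L(a)` of factorizations of `a` into atoms of `H`. -/
def lengthsOf {G : Type*} [Group G] (H : Submonoid G) (a : G) : Set ℕ :=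
  {k | ∃ l : List G, l.length = k ∧ (∀ x ∈ l, IsAtomOf H x) ∧ a = l.prod}

section OrderedMonoid

variable {M : Type*} [Monoid M] [Preorder M]

/-- `p` is maximal among the elements which are not above `1`. -/
def IsMaxBelowOne (p : M) : Prop :=
  ¬ 1 ≤ p ∧ ∀ q, p ≤ q → ¬ 1 ≤ q → q ≤ p

theorem exists_isMaxBelowOne_ge [WellFoundedGT M] (a : M) (ha : ¬ 1 ≤ a) :
    ∃ p, IsMaxBelowOne p ∧ a ≤ p := by
  induction a using WellFoundedGT.induction with
  | ind a ih =>
    by_cases h : ∃ b, a < b ∧ ¬ 1 ≤ b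
    · obtain ⟨b, hab, hb⟩ := h
      obtain ⟨p, hp, hbp⟩ := ih b hab hb
      exact ⟨p, hp, hab.le.trans hbp⟩
    · refine ⟨a, ⟨ha, fun q haq hq => ?_⟩, le_rfl⟩
      by_contra hqa
      exact h ⟨q, lt_of_le_not_ge haq hqa, hq⟩

/-- Properties of the monoid of non-empty ideals of a completely integrally closed monoid,
preordered by inclusion of divisorial closures. -/
structure IsDivisorialLike (M : Type*) [Monoid M] [Preorder M] : Prop where
  le_one (a : M) : a ≤ 1
  mul_mono {a b c d : M} : a ≤ b → c ≤ d → a * c ≤ b * d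
  exists_mul {a b : M} : a ≤ b → ∃ x, a ≤ b * x ∧ b * x ≤ a
  le_of_mul_le_mul_left {p a b : M} : p * a ≤ p * b → a ≤ b
  le_of_mul_le_mul_right {p a b : M} : a * p ≤ b * p → a ≤ b
  exists_sup (p q : M) : ∃ u, p ≤ u ∧ q ≤ u ∧ ∀ x r, p * x ≤ r → q * x ≤ r → u * x ≤ r

namespace IsDivisorialLike

variable (hM : IsDivisorialLike M)
include hM

theorem mul_le_left (a b : M) : a * b ≤ a := by
  simpa using hM.mul_mono (le_refl a) (hM.le_one b)

theorem mul_le_right (a b : M) : a * b ≤ b := by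
  simpa using hM.mul_mono (hM.le_one a) (le_refl b)

theorem le_of_mul_le_of_not_le {p q x : M} (hq : IsMaxBelowOne q)
    (hpq : ¬ p ≤ q) (h : p * x ≤ q) : x ≤ q := by
  obtain ⟨u, hpu, hqu, hu⟩ := hM.exists_sup p q
  have h1 : 1 ≤ u := by
    by_contra hu1
    exact hpq (hpu.trans (hq.2 u hqu hu1))
  simpa using (hM.mul_mono h1 (le_refl x)).trans (hu x q h (hM.mul_le_left q x))

theorem mul_le_mul_swap {p q : M} (hq : IsMaxBelowOne q)
    (hpq : ¬ p ≤ q) : q * p ≤ p * q := by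
  obtain ⟨x, h1, h2⟩ := hM.exists_mul (hM.mul_le_right q p)
  have hx : x ≤ q :=
    hM.le_of_mul_le_of_not_le hq hpq (h2.trans (hM.mul_le_left q p))
  exact h1.trans (hM.mul_mono le_rfl hx)

theorem exists_list_of_mul_le_prod {p : M} (hp : IsMaxBelowOne p) (l : List M) :
    ∀ a : M, (∀ q ∈ l, IsMaxBelowOne q) → p * a ≤ l.prod →
      ∃ l' : List M, (∀ q ∈ l', IsMaxBelowOne q) ∧ a ≤ l'.prod ∧ l.length ≤ l'.length + 1 := by
  induction l with
  | nil => exact fun a _ _ => ⟨[], by simp, by simpa using hM.le_one a, by simp⟩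
  | cons q l ih =>
    intro a hl h
    have hq : IsMaxBelowOne q := hl q (by simp)
    have hl' : ∀ q ∈ l, IsMaxBelowOne q := fun r hr => hl r (by simp [hr])
    rw [List.prod_cons] at h
    by_cases hpq : p ≤ q
    · refine ⟨l, hl', ?_, by simp⟩
      exact hM.le_of_mul_le_mul_left
        ((hM.mul_mono (hp.2 q hpq hq.1) (le_refl a)).trans h)
    · have haq : a ≤ q :=
        hM.le_of_mul_le_of_not_le hq hpq (h.trans (hM.mul_le_left _ _))
      obtain ⟨b, hab, hba⟩ := hM.exists_mul haq
      have hb : q * (p * b) ≤ q * l.prod := by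
        calc q * (p * b) = q * p * b := (mul_assoc _ _ _).symm
          _ ≤ p * q * b := hM.mul_mono (hM.mul_le_mul_swap hq hpq) le_rfl
          _ = p * (q * b) := mul_assoc _ _ _
          _ ≤ p * a := hM.mul_mono le_rfl hba
          _ ≤ q * l.prod := h
      obtain ⟨l', h1, h2, h3⟩ := ih b hl' (hM.le_of_mul_le_mul_left hb)
      refine ⟨q :: l', ?_, ?_, by simpa using h3⟩
      · simpa using ⟨hq, h1⟩
      · rw [List.prod_cons]
        exact hab.trans (hM.mul_mono le_rfl h2)

theorem exists_isMaxBelowOne_list [WellFoundedGT M] (l : List M) (hl : ∀ q ∈ l, ¬ 1 ≤ q) :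
    ∃ l' : List M, (∀ q ∈ l', IsMaxBelowOne q) ∧ l.prod ≤ l'.prod ∧ l'.length = l.length := by
  induction l with
  | nil => exact ⟨[], by simp⟩
  | cons q l ih =>
    obtain ⟨l', h1, h2, h3⟩ := ih fun r hr => hl r (by simp [hr])
    obtain ⟨p, hp, hqp⟩ := exists_isMaxBelowOne_ge q (hl q (by simp))
    refine ⟨p :: l', by simpa using ⟨hp, h1⟩, ?_, by simp [h3]⟩
    simpa using hM.mul_mono hqp h2

theorem exists_length_le_of_isMaxBelowOne [WellFoundedGT M] (a : M) :
    ∃ N : ℕ, ∀ l : List M, (∀ q ∈ l, IsMaxBelowOne q) → a ≤ l.prod → l.length ≤ N := by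
  induction a using WellFoundedGT.induction with
  | ind a ih =>
    by_cases ha : 1 ≤ a
    · refine ⟨0, fun l hl h => ?_⟩
      cases l with
      | nil => simp
      | cons q l =>
        rw [List.prod_cons] at h
        exact absurd (ha.trans (h.trans (hM.mul_le_left _ _))) (hl q (by simp)).1
    · obtain ⟨p, hp, hap⟩ := exists_isMaxBelowOne_ge a ha
      obtain ⟨b, hab, hba⟩ := hM.exists_mul hap
      have hlt : a < b := by
        refine lt_of_le_not_ge (hab.trans (hM.mul_le_right _ _)) fun h => hp.1 ?_
        exact hM.le_of_mul_le_mul_right (p := b) (by simpa using h.trans hab)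
      obtain ⟨N, hN⟩ := ih b hlt
      refine ⟨N + 1, fun l hl h => ?_⟩
      obtain ⟨l', h1, h2, h3⟩ := hM.exists_list_of_mul_le_prod hp l b hl (hba.trans h)
      exact h3.trans (Nat.succ_le_succ (hN l' h1 h2))

theorem exists_length_le [WellFoundedGT M] (a : M) :
    ∃ N : ℕ, ∀ l : List M, (∀ q ∈ l, ¬ 1 ≤ q) → a ≤ l.prod → l.length ≤ N := by
  obtain ⟨N, hN⟩ := hM.exists_length_le_of_isMaxBelowOne a
  refine ⟨N, fun l hl h => ?_⟩
  obtain ⟨l', h1, h2, h3⟩ := hM.exists_isMaxBelowOne_list l hl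
  exact h3 ▸ hN l' h1 (h.trans h2)

end IsDivisorialLike

end OrderedMonoid

section Ideals

variable {G : Type*} [Group G] {H : Submonoid G}

theorem isIdeal_of_mem {A : Set G} (h : A ⊆ (H : Set G))
    (hl : ∀ c ∈ H, ∀ x ∈ A, c * x ∈ A) (hr : ∀ x ∈ A, ∀ c ∈ H, x * c ∈ A) : IsIdeal H A := by
  refine ⟨h, subset_antisymm ?_ ?_, subset_antisymm ?_ ?_⟩
  · rintro _ ⟨c, hc, x, hx, rfl⟩
    exact hl c hc x hx
  · exact fun x hx => ⟨1, H.one_mem, x, hx, one_mul x⟩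
  · rintro _ ⟨x, hx, c, hc, rfl⟩
    exact hr x hx c hc
  · exact fun x hx => ⟨x, hx, 1, H.one_mem, mul_one x⟩

namespace IsIdeal

variable {A B : Set G}

theorem mul_mem_left (hA : IsIdeal H A) {c x : G} (hc : c ∈ H) (hx : x ∈ A) : c * x ∈ A :=
  hA.2.1 ▸ Set.mul_mem_mul hc hx

theorem mul_mem_right (hA : IsIdeal H A) {c x : G} (hx : x ∈ A) (hc : c ∈ H) : x * c ∈ A := by
  have h := Set.mul_mem_mul hx (show c ∈ (H : Set G) from hc)
  rwa [hA.2.2] at h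

theorem mul (hA : IsIdeal H A) (hB : IsIdeal H B) : IsIdeal H (A * B) := by
  refine ⟨?_, ?_, ?_⟩
  · rintro _ ⟨a, ha, b, hb, rfl⟩
    exact H.mul_mem (hA.1 ha) (hB.1 hb)
  · rw [← mul_assoc, hA.2.1]
  · rw [mul_assoc, hB.2.2]

theorem union (hA : IsIdeal H A) (hB : IsIdeal H B) : IsIdeal H (A ∪ B) :=
  ⟨Set.union_subset hA.1 hB.1, by rw [Set.mul_union, hA.2.1, hB.2.1],
    by rw [Set.union_mul, hA.2.2, hB.2.2]⟩

theorem coe_self : IsIdeal H (H : Set G) :=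
  isIdeal_of_mem subset_rfl (fun _ hc _ hx => H.mul_mem hc hx) fun _ hx _ hc => H.mul_mem hx hc

theorem one_mem_lq (hA : IsIdeal H A) : (1 : G) ∈ lq (H : Set G) A :=
  fun a ha => by simpa using hA.1 ha

theorem mul_mem_lq_left {c x : G} (hc : c ∈ H) (hx : x ∈ lq (H : Set G) A) :
    c * x ∈ lq (H : Set G) A := fun a ha => by
  rw [mul_assoc]
  exact H.mul_mem hc (hx a ha)

theorem mul_mem_lq_right (hA : IsIdeal H A) {c x : G} (hx : x ∈ lq (H : Set G) A) (hc : c ∈ H) :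
    x * c ∈ lq (H : Set G) A := fun a ha => by
  rw [mul_assoc]
  exact hx _ (hA.mul_mem_left hc ha)

end IsIdeal

namespace IsCIC

variable {A B : Set G}

theorem mem_of_left (hH : IsCIC H) (hA : IsIdeal H A) (hne : A.Nonempty) {x : G}
    (hx : ∀ a ∈ A, x * a ∈ A) : x ∈ H := by
  have h : x ∈ lq A A := hx
  rwa [(hH A hA hne).1] at h

theorem mem_of_right (hH : IsCIC H) (hA : IsIdeal H A) (hne : A.Nonempty) {x : G}
    (hx : ∀ a ∈ A, a * x ∈ A) : x ∈ H := by
  have h : x ∈ rq A A := hx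
  rwa [(hH A hA hne).2] at h

theorem rq_eq_lq (hH : IsCIC H) (hA : IsIdeal H A) (hne : A.Nonempty) :
    rq (H : Set G) A = lq (H : Set G) A := by
  ext x
  constructor
  · intro hx a ha
    refine hH.mem_of_right hA hne fun b hb => ?_
    rw [← mul_assoc]
    exact hA.mul_mem_left (hx b hb) ha
  · intro hx a ha
    refine hH.mem_of_left hA hne fun b hb => ?_
    rw [mul_assoc]
    exact hA.mul_mem_right ha (hx b hb)

theorem mul_mem_of_mem_lq (hH : IsCIC H) (hA : IsIdeal H A) (hne : A.Nonempty) {a x : G}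
    (ha : a ∈ A) (hx : x ∈ lq (H : Set G) A) : a * x ∈ H := by
  rw [← hH.rq_eq_lq hA hne] at hx
  exact hx a ha

theorem isIdeal_lq_mul (hA : IsIdeal H A)
    (h : lq (H : Set G) B ⊆ lq (H : Set G) A) : IsIdeal H (lq (H : Set G) B * A) := by
  refine isIdeal_of_mem ?_ ?_ ?_
  · rintro _ ⟨x, hx, a, ha, rfl⟩
    exact h hx a ha
  · rintro c hc _ ⟨x, hx, a, ha, rfl⟩
    exact ⟨c * x, IsIdeal.mul_mem_lq_left hc hx, a, ha, mul_assoc _ _ _⟩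
  · rintro _ ⟨x, hx, a, ha, rfl⟩ c hc
    exact ⟨x, hx, a * c, hA.mul_mem_right ha hc, (mul_assoc _ _ _).symm⟩

theorem isIdeal_mul_lq (hH : IsCIC H) (hA : IsIdeal H A) (hne : A.Nonempty) :
    IsIdeal H (A * lq (H : Set G) A) := by
  refine isIdeal_of_mem ?_ ?_ ?_
  · rintro _ ⟨a, ha, x, hx, rfl⟩
    exact hH.mul_mem_of_mem_lq hA hne ha hx
  · rintro c hc _ ⟨a, ha, x, hx, rfl⟩
    exact ⟨c * a, hA.mul_mem_left hc ha, x, hx, mul_assoc _ _ _⟩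
  · rintro _ ⟨a, ha, x, hx, rfl⟩ c hc
    exact ⟨a, ha, x * c, hA.mul_mem_lq_right hx hc, (mul_assoc _ _ _).symm⟩

theorem mul_lq_nonempty (hA : IsIdeal H A) (hne : A.Nonempty) :
    (A * lq (H : Set G) A).Nonempty := hne.mul ⟨1, hA.one_mem_lq⟩

theorem lq_mul_nonempty (hB : IsIdeal H B) (hne : A.Nonempty) :
    (lq (H : Set G) B * A).Nonempty := Set.Nonempty.mul ⟨1, hB.one_mem_lq⟩ hne

theorem mem_of_mul_lq_subset (hH : IsCIC H) (hA : IsIdeal H A) (hne : A.Nonempty) {y : G}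
    (hy : ∀ x ∈ lq (H : Set G) A, y * x ∈ lq (H : Set G) A) : y ∈ H := by
  refine hH.mem_of_left (isIdeal_lq_mul hA subset_rfl) (lq_mul_nonempty hA hne) ?_
  rintro _ ⟨x, hx, a, ha, rfl⟩
  exact ⟨y * x, hy x hx, a, ha, mul_assoc _ _ _⟩

theorem mem_of_lq_mul_subset (hH : IsCIC H) (hA : IsIdeal H A) (hne : A.Nonempty) {y : G}
    (hy : ∀ x ∈ lq (H : Set G) A, x * y ∈ lq (H : Set G) A) : y ∈ H := by
  refine hH.mem_of_right (hH.isIdeal_mul_lq hA hne) (mul_lq_nonempty hA hne) ?_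
  rintro _ ⟨a, ha, x, hx, rfl⟩
  exact ⟨a, ha, x * y, hy x hx, (mul_assoc _ _ _).symm⟩

theorem rq_lq_eq_lq_lq (hH : IsCIC H) (hA : IsIdeal H A) (hne : A.Nonempty) :
    rq (H : Set G) (lq (H : Set G) A) = lq (H : Set G) (lq (H : Set G) A) := by
  ext z
  constructor
  · intro hz x hx
    refine hH.mem_of_lq_mul_subset hA hne fun y hy => ?_
    rw [← mul_assoc]
    exact IsIdeal.mul_mem_lq_left (hz y hy) hx
  · intro hz x hx
    refine hH.mem_of_mul_lq_subset hA hne fun y hy => ?_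
    rw [mul_assoc]
    exact hA.mul_mem_lq_right hx (hz y hy)

theorem subset_lq_lq (hH : IsCIC H) (hA : IsIdeal H A) (hne : A.Nonempty) :
    A ⊆ lq (H : Set G) (lq (H : Set G) A) :=
  fun _ ha _ hx => hH.mul_mem_of_mem_lq hA hne ha hx

theorem isIdeal_lq_lq (hA : IsIdeal H A) :
    IsIdeal H (lq (H : Set G) (lq (H : Set G) A)) := by
  refine isIdeal_of_mem (fun z hz => ?_) (fun c hc z hz => IsIdeal.mul_mem_lq_left hc hz)
    fun z hz c hc x hx => ?_
  · simpa using hz 1 hA.one_mem_lq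
  · rw [mul_assoc]
    exact hz _ (IsIdeal.mul_mem_lq_left hc hx)

theorem lq_lq_lq (hH : IsCIC H) (hA : IsIdeal H A) (hne : A.Nonempty) :
    lq (H : Set G) (lq (H : Set G) (lq (H : Set G) A)) = lq (H : Set G) A := by
  apply subset_antisymm
  · exact fun x hx a ha => hx a (hH.subset_lq_lq hA hne ha)
  · intro x hx z hz
    rw [← hH.rq_lq_eq_lq_lq hA hne] at hz
    exact hz x hx

theorem isDivIdealFull_lq_lq (hH : IsCIC H) (hA : IsIdeal H A) (hne : A.Nonempty) :
    IsDivIdealFull H (lq (H : Set G) (lq (H : Set G) A)) := by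
  have hI := isIdeal_lq_lq hA
  have hIne := hne.mono (hH.subset_lq_lq hA hne)
  refine ⟨hI, ?_, ?_⟩
  · rw [hH.rq_eq_lq hI hIne, hH.lq_lq_lq hA hne]
  · rw [hH.lq_lq_lq hA hne, hH.rq_lq_eq_lq_lq hA hne]

end IsCIC

theorem lq_coe_self : lq (H : Set G) (H : Set G) = H :=
  subset_antisymm (fun x hx => by simpa using hx 1 H.one_mem) fun _ hx _ hc => H.mul_mem hx hc

theorem IsDivIdealFull.eq_coe_of_lq_subset {I : Set G} (hI : IsDivIdealFull H I)
    (h : lq (H : Set G) I ⊆ H) : I = H := by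
  refine subset_antisymm hI.1.1 fun x hx => ?_
  rw [hI.2.2]
  exact fun y hy => H.mul_mem (h hy) hx

variable (H) in
/-- The non-empty ideals of `H`. -/
def NonemptyIdeal : Type _ := {A : Set G // IsIdeal H A ∧ A.Nonempty}

namespace NonemptyIdeal

instance : Monoid (NonemptyIdeal H) where
  mul A B := ⟨A.1 * B.1, A.2.1.mul B.2.1, A.2.2.mul B.2.2⟩
  one := ⟨H, IsIdeal.coe_self, 1, H.one_mem⟩
  mul_assoc A B C := Subtype.ext (mul_assoc A.1 B.1 C.1)
  one_mul A := Subtype.ext A.2.1.2.1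
  mul_one A := Subtype.ext A.2.1.2.2

theorem val_mul (A B : NonemptyIdeal H) : (A * B).1 = A.1 * B.1 := rfl

theorem val_one : (1 : NonemptyIdeal H).1 = H := rfl

/-- The preorder given by inclusion of divisorial closures. -/
instance : Preorder (NonemptyIdeal H) where
  le A B := lq (H : Set G) B.1 ⊆ lq (H : Set G) A.1
  le_refl _ := subset_rfl
  le_trans _ _ _ h₁ h₂ := h₂.trans h₁

theorem le_of_subset {A B : NonemptyIdeal H} (h : A.1 ⊆ B.1) : A ≤ B :=
  fun _ hx a ha => hx a (h ha)

variable (hH : IsCIC H)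
include hH

theorem mul_mono {A B C D : NonemptyIdeal H} (hAB : A ≤ B) (hCD : C ≤ D) :
    A * C ≤ B * D := by
  have h₁ : A * D ≤ B * D := by
    intro x hx
    have hx' : x ∈ rq (H : Set G) (B * D).1 := by
      rwa [hH.rq_eq_lq (B * D).2.1 (B * D).2.2]
    rw [← hH.rq_eq_lq (A * D).2.1 (A * D).2.2]
    rintro _ ⟨a, ha, d, hd, rfl⟩
    have hdx : d * x ∈ lq (H : Set G) B.1 := by
      rw [← hH.rq_eq_lq B.2.1 B.2.2]
      intro b hb
      rw [← mul_assoc]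
      exact hx' _ (Set.mul_mem_mul hb hd)
    rw [mul_assoc]
    exact hH.mul_mem_of_mem_lq A.2.1 A.2.2 ha (hAB hdx)
  have h₂ : A * C ≤ A * D := by
    rintro x hx _ ⟨a, ha, c, hc, rfl⟩
    rw [← mul_assoc]
    refine hCD (fun d hd => ?_) c hc
    rw [mul_assoc]
    exact hx _ (Set.mul_mem_mul ha hd)
  exact h₂.trans h₁

theorem exists_mul {A B : NonemptyIdeal H} (h : A ≤ B) :
    ∃ X, A ≤ B * X ∧ B * X ≤ A := by
  let J : NonemptyIdeal H :=
    ⟨B.1 * lq (H : Set G) B.1, hH.isIdeal_mul_lq B.2.1 B.2.2, IsCIC.mul_lq_nonempty B.2.1 B.2.2⟩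
  let X : NonemptyIdeal H :=
    ⟨lq (H : Set G) B.1 * A.1, IsCIC.isIdeal_lq_mul A.2.1 h,
      IsCIC.lq_mul_nonempty B.2.1 A.2.2⟩
  have hJX : B * X = J * A := Subtype.ext (mul_assoc B.1 (lq (H : Set G) B.1) A.1).symm
  have hJ : 1 ≤ J := by
    intro x hx
    rw [val_one, lq_coe_self]
    refine hH.mem_of_lq_mul_subset B.2.1 B.2.2 fun y hy => ?_
    rw [← hH.rq_eq_lq B.2.1 B.2.2]
    intro b hb
    rw [← mul_assoc]
    exact hH.mul_mem_of_mem_lq J.2.1 J.2.2 (Set.mul_mem_mul hb hy) hx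
  refine ⟨X, ?_, ?_⟩
  · rw [hJX]
    simpa using mul_mono hH hJ (le_refl A)
  · rw [hJX]
    refine le_of_subset ?_
    rintro _ ⟨j, hj, a, ha, rfl⟩
    exact A.2.1.mul_mem_left (J.2.1.1 hj) ha

theorem le_of_mul_le_mul_right {P A B : NonemptyIdeal H} (h : A * P ≤ B * P) : A ≤ B := by
  intro x hx a ha
  refine hH.mem_of_lq_mul_subset P.2.1 P.2.2 fun y hy p hp => ?_
  have hyx : y * x ∈ lq (H : Set G) (B * P).1 := by
    rintro _ ⟨b, hb, q, hq, rfl⟩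
    have hxb := P.2.1.mul_mem_left (hx b hb) hq
    simpa [mul_assoc] using hy _ hxb
  simpa [mul_assoc] using h hyx _ (Set.mul_mem_mul ha hp)

theorem le_of_mul_le_mul_left {P A B : NonemptyIdeal H} (h : P * A ≤ P * B) : A ≤ B := by
  intro x hx
  rw [← hH.rq_eq_lq A.2.1 A.2.2]
  intro a ha
  refine hH.mem_of_mul_lq_subset P.2.1 P.2.2 fun y hy => ?_
  have hxy : x * y ∈ lq (H : Set G) (P * B).1 := by
    rw [← hH.rq_eq_lq (P * B).2.1 (P * B).2.2]
    rintro _ ⟨p, hp, b, hb, rfl⟩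
    have hbx := P.2.1.mul_mem_right hp (hH.mul_mem_of_mem_lq B.2.1 B.2.2 hb hx)
    simpa [mul_assoc] using hH.mul_mem_of_mem_lq P.2.1 P.2.2 hbx hy
  rw [← hH.rq_eq_lq P.2.1 P.2.2]
  intro p hp
  simpa [mul_assoc] using
    hH.mul_mem_of_mem_lq (P * A).2.1 (P * A).2.2 (Set.mul_mem_mul hp ha) (h hxy)

theorem isDivisorialLike : IsDivisorialLike (NonemptyIdeal H) where
  le_one A := le_of_subset A.2.1.1
  mul_mono := mul_mono hH
  exists_mul := exists_mul hH
  le_of_mul_le_mul_left := le_of_mul_le_mul_left hH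
  le_of_mul_le_mul_right := le_of_mul_le_mul_right hH
  exists_sup P Q := by
    refine ⟨⟨P.1 ∪ Q.1, P.2.1.union Q.2.1, P.2.2.inl⟩, le_of_subset Set.subset_union_left,
      le_of_subset Set.subset_union_right, ?_⟩
    rintro X R hP hQ y hy _ ⟨u, hu | hu, x, hx, rfl⟩
    · exact hP hy _ (Set.mul_mem_mul hu hx)
    · exact hQ hy _ (Set.mul_mem_mul hu hx)

theorem wellFoundedGT (hN : VNoethFull H) : WellFoundedGT (NonemptyIdeal H) := by
  rw [wellFoundedGT_iff_monotone_chain_condition']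
  intro f
  obtain ⟨N, h⟩ := hN (fun n => lq (H : Set G) (lq (H : Set G) (f n).1))
    (fun n => hH.isDivIdealFull_lq_lq (f n).2.1 (f n).2.2)
    (fun n z hz x hx => hz x (f.monotone n.le_succ hx))
  refine ⟨N, fun m hm hlt => hlt.not_ge ?_⟩
  have heq := congrArg (lq (H : Set G)) (h m hm)
  rw [hH.lq_lq_lq (f m).2.1 (f m).2.2, hH.lq_lq_lq (f N).2.1 (f N).2.2] at heq
  exact heq.ge

end NonemptyIdeal

/-- The ideal `HaH` generated by an element `a` of `H`. -/
def principalIdeal (a : H) : NonemptyIdeal H :=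
  ⟨(H : Set G) * {(a : G)} * H, by
    refine ⟨?_, ?_, ?_⟩
    · rintro _ ⟨_, ⟨c, hc, _, rfl, rfl⟩, d, hd, rfl⟩
      exact H.mul_mem (H.mul_mem hc a.2) hd
    · rw [← mul_assoc, ← mul_assoc, IsIdeal.coe_self.2.1]
    · rw [mul_assoc, IsIdeal.coe_self.2.1],
    ⟨_, Set.mul_mem_mul (Set.mul_mem_mul H.one_mem rfl) H.one_mem⟩⟩

theorem principalIdeal_subset {a : H} {I : Set G} (hI : IsIdeal H I) (ha : (a : G) ∈ I) :
    (principalIdeal a).1 ⊆ I := by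
  rintro _ ⟨_, ⟨c, hc, _, rfl, rfl⟩, d, hd, rfl⟩
  exact hI.mul_mem_right (hI.mul_mem_left hc ha) hd

theorem mem_principalIdeal (a : H) : (a : G) ∈ (principalIdeal a).1 :=
  ⟨_, ⟨1, H.one_mem, _, rfl, rfl⟩, 1, H.one_mem, by simp⟩

theorem prod_mem_prod_principalIdeal (l : List H) :
    (l.prod : G) ∈ (l.map principalIdeal).prod.1 := by
  induction l with
  | nil => exact H.one_mem
  | cons a l ih =>
    simp only [List.map_cons, List.prod_cons, Submonoid.coe_mul, NonemptyIdeal.val_mul]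
    exact Set.mul_mem_mul (mem_principalIdeal a) ih

/-- Factorizations of a fixed element into non-units have bounded length. -/
theorem exists_length_le_of_prod_eq (hkrull : IsKrull H)
    (hdiv : ∀ a ∈ H, a ∉ unitSet H →
      ∃ I : Set G, IsDivIdealFull H I ∧ I ≠ (H : Set G) ∧ a ∈ I) {a : G} (ha : a ∈ H) :
    ∃ N : ℕ, ∀ l : List G, (∀ x ∈ l, x ∈ H ∧ x ∉ unitSet H) → a = l.prod → l.length ≤ N := by
  have := NonemptyIdeal.wellFoundedGT hkrull.1 hkrull.2
  obtain ⟨N, hN⟩ :=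
    (NonemptyIdeal.isDivisorialLike hkrull.1).exists_length_le (principalIdeal ⟨a, ha⟩)
  refine ⟨N, fun l hl hal => ?_⟩
  lift l to List H using fun x hx => (hl x hx).1
  have h := hN (l.map principalIdeal) ?_ ?_
  · simpa using h
  · simp only [List.mem_map]
    rintro _ ⟨x, hx, rfl⟩ h1
    obtain ⟨I, hI, hne, hxI⟩ := hdiv x x.2 (hl x (List.mem_map_of_mem hx)).2
    refine hne (hI.eq_coe_of_lq_subset fun y hy => ?_)
    have hy' := h1 fun b hb => hy b (principalIdeal_subset hI.1 hxI hb)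
    rwa [NonemptyIdeal.val_one, lq_coe_self] at hy'
  · refine NonemptyIdeal.le_of_subset (principalIdeal_subset (l.map principalIdeal).prod.2.1 ?_)
    have hmem := prod_mem_prod_principalIdeal l
    rw [Submonoid.coe_list_prod] at hmem
    rwa [← hal] at hmem

theorem exists_atom_list {a : G} {N : ℕ}
    (hN : ∀ l : List G, (∀ x ∈ l, x ∈ H ∧ x ∉ unitSet H) → a = l.prod → l.length ≤ N)
    (l : List G) (hl : ∀ x ∈ l, x ∈ H ∧ x ∉ unitSet H) (hal : a = l.prod) :
    ∃ l' : List G, (∀ x ∈ l', IsAtomOf H x) ∧ a = l'.prod := by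
  induction hk : N - l.length using Nat.strong_induction_on generalizing l with
  | _ k ih =>
    by_cases h : ∀ x ∈ l, IsAtomOf H x
    · exact ⟨l, h, hal⟩
    · push Not at h
      obtain ⟨x, hx, hxa⟩ := h
      obtain ⟨s, t, rfl⟩ := List.append_of_mem hx
      have hsplit : ∃ u ∈ H, ∃ v ∈ H, x = u * v ∧ u ∉ unitSet H ∧ v ∉ unitSet H := by
        by_contra hc
        push Not at hc
        exact hxa ⟨(hl x hx).1, (hl x hx).2, fun u hu v hv huv =>
          or_iff_not_imp_left.2 fun hu' => hc u hu v hv huv hu'⟩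
      obtain ⟨u, hu, v, hv, rfl, hu', hv'⟩ := hsplit
      have hmem : ∀ x ∈ s ++ u :: v :: t, x ∈ H ∧ x ∉ unitSet H := by
        intro y hy
        simp only [List.mem_append, List.mem_cons] at hy hl
        rcases hy with hy | rfl | rfl | hy
        · exact hl y (Or.inl hy)
        · exact ⟨hu, hu'⟩
        · exact ⟨hv, hv'⟩
        · exact hl y (Or.inr (Or.inr hy))
      have hprod : a = (s ++ u :: v :: t).prod := by
        rw [hal]
        simp [mul_assoc]
      have hlen := hN _ hmem hprod
      refine ih _ ?_ _ hmem hprod rfl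
      simp only [List.length_append, List.length_cons] at hlen hk ⊢
      omega

end Ideals

/-- If `H` is a Krull monoid in which every non-unit lies in a divisorial ideal
distinct from `H`, then `H` is a BF-monoid. -/
theorem stmt19 {G : Type*} [Group G] (H : Submonoid G) (hq : IsQG H)
    (hkrull : IsKrull H)
    (hdiv : ∀ a ∈ H, a ∉ unitSet H →
      ∃ I : Set G, IsDivIdealFull H I ∧ I ≠ (H : Set G) ∧ a ∈ I) :
    ∀ a ∈ H, a ∉ unitSet H →
      (lengthsOf H a).Finite ∧ (lengthsOf H a).Nonempty := by
  intro a ha hau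
  obtain ⟨N, hN⟩ := exists_length_le_of_prod_eq hkrull hdiv ha
  constructor
  · refine (Set.finite_Iic N).subset ?_
    rintro _ ⟨l, rfl, hl, hal⟩
    exact hN l (fun x hx => ⟨(hl x hx).1, (hl x hx).2.1⟩) hal
  · obtain ⟨l, hl, hal⟩ := exists_atom_list hN [a] (by simpa using ⟨ha, hau⟩) (by simp)
    exact ⟨l.length, l, rfl, hl, hal⟩
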